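/- Let ℱ be a family of finite graphs with χ(ℱ) ≥ 2, and let F ∈ ℱ satisfy χ(F) = χ(ℱ) and α(F) = α(ℱ). For every ε > 0 and every finite comparability graph G, if t(F,G) ≤ (ε/2)^{χ(ℱ)·α(ℱ)²}, then there exists a spanning subgraph of G that is a comparability graph, is K_{χ(ℱ)}-free (and hence contains no member of ℱ as a subgraph), and is obtained by deleting at most ε·|V(G)|² edges of G. -/

import Mathlib

/-- A strict partial order relation: irreflexive and transitive. -/
def IsStrictOrd {α : Type*} (r : α → α → Prop) : Prop :=
  (∀ x, ¬ r x x) ∧ (∀ ⦃x y z⦄, r x y → r y z → r x z)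

/-- A comparability graph: adjacency is comparability in some strict partial order. -/
def IsComparability {V : Type*} (G : SimpleGraph V) : Prop :=
  ∃ r : V → V → Prop, IsStrictOrd r ∧ ∀ x y, G.Adj x y ↔ (r x y ∨ r y x)

/-- A graph homomorphism: every edge of `F` is mapped to an edge of `G`. -/
def IsGraphHom {W V : Type*} (F : SimpleGraph W) (G : SimpleGraph V) (f : W → V) : Prop :=
  ∀ ⦃x y⦄, F.Adj x y → G.Adj (f x) (f y)

/-- The homomorphism density `t(F,G)`: the probability that a uniformly random map from
`V(F)` to `V(G)` is a graph homomorphism. -/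
noncomputable def graphHomDensity {W V : Type*} [Fintype W] [Fintype V]
    (F : SimpleGraph W) (G : SimpleGraph V) : ℝ :=
  (Nat.card {f : W → V // IsGraphHom F G f} : ℝ) / (Fintype.card V : ℝ) ^ (Fintype.card W)

/-- The chromatic number of a finite graph. -/
noncomputable def chromNum {V : Type*} [Fintype V] (G : SimpleGraph V) : ℕ :=
  sInf {n | G.Colorable n}

/-- The independence number of a finite graph. -/
noncomputable def indepNum {V : Type*} [Fintype V] (G : SimpleGraph V) : ℕ :=
  sSup {n | ∃ s : Finset V, s.card = n ∧ ∀ x ∈ s, ∀ y ∈ s, ¬ G.Adj x y}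

/-- `G` is `F`-free: no injective graph homomorphism from `F` to `G`,
i.e. no (not necessarily induced) subgraph isomorphic to `F`. -/
def GraphFreeOf {W V : Type*} (F : SimpleGraph W) (G : SimpleGraph V) : Prop :=
  ¬ ∃ f : W → V, Function.Injective f ∧ IsGraphHom F G f

/-- The number of edges of `G` deleted to obtain the spanning subgraph `G'`. -/
noncomputable def deletedEdges {V : Type*} [Fintype V] (G G' : SimpleGraph V) : ℕ :=
  Nat.card {e : Sym2 V // e ∈ G.edgeSet ∧ e ∉ G'.edgeSet}

/-- A finite graph with vertex set `Fin n`. -/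
structure FinGraph where
  n : ℕ
  graph : SimpleGraph (Fin n)

/-- The chromatic number of a family of finite graphs: the minimum chromatic number
of a member. -/
noncomputable def famChrom (ℱ : Set FinGraph) : ℕ :=
  sInf {m | ∃ F ∈ ℱ, chromNum F.graph = m}

/-- The independence number of a family of finite graphs: the minimum independence number
of a member of minimum chromatic number. -/
noncomputable def famIndep (ℱ : Set FinGraph) : ℕ :=
  sInf {m | ∃ F ∈ ℱ, chromNum F.graph = famChrom ℱ ∧ indepNum F.graph = m}

/-- The proportion of elements of a finite type satisfying a predicate. -/
noncomputable def finDensity {α : Type*} (P : α → Prop) : ℝ :=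
  (Nat.card {x // P x} : ℝ) / (Nat.card α : ℝ)

lemma finDensity_nonneg {α : Type*} (P : α → Prop) : 0 ≤ finDensity P := by
  unfold finDensity; positivity

lemma finDensity_mono {α : Type*} [Finite α] {P Q : α → Prop} (h : ∀ x, P x → Q x) :
    finDensity P ≤ finDensity Q := by
  unfold finDensity
  gcongr
  exact Nat.card_le_card_of_injective (Subtype.map id h)
    (Subtype.map_injective h Function.injective_id)

lemma finDensity_comp_equiv {α β : Type*} (e : α ≃ β) (P : β → Prop) :
    finDensity (fun x => P (e x)) = finDensity P := by
  unfold finDensity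
  rw [Nat.card_congr e, Nat.card_congr (e.subtypeEquiv (q := P) fun _ => Iff.rfl)]

lemma finDensity_comp_fst {α β : Type*} [Finite β] [Nonempty β] (P : α → Prop) :
    finDensity (fun x : α × β => P x.1) = finDensity P := by
  unfold finDensity
  have e : {x : α × β // P x.1} ≃ {x // P x} × β :=
    { toFun := fun x => (⟨x.1.1, x.2⟩, x.1.2)
      invFun := fun x => ⟨(x.1.1, x.2), x.1.2⟩
      left_inv := fun _ => rfl
      right_inv := fun _ => rfl }
  have hβ : (Nat.card β : ℝ) ≠ 0 := by exact_mod_cast Nat.card_pos.ne'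
  rw [Nat.card_congr e, Nat.card_prod, Nat.card_prod]
  push_cast
  exact mul_div_mul_right _ _ hβ

/-- Restricting a uniformly random map along an injection gives a uniformly random map. -/
lemma finDensity_comp_injective {W I V : Type*} [Finite I] [Finite V] [Nonempty V]
    {ι : W → I} (hι : Function.Injective ι) (P : (W → V) → Prop) :
    finDensity (fun g : I → V => P (g ∘ ι)) = finDensity P := by
  classical
  let e : W ⊕ ((Set.range ι)ᶜ : Set I) ≃ I :=
    (Equiv.sumCongr (Equiv.ofInjective ι hι) (Equiv.refl _)).trans (Equiv.Set.sumCompl _)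
  have he : ∀ w, e (Sum.inl w) = ι w := fun w => rfl
  let E : (I → V) ≃ (W → V) × (((Set.range ι)ᶜ : Set I) → V) :=
    (Equiv.arrowCongr e.symm (Equiv.refl V)).trans (Equiv.sumArrowEquivProdArrow _ _ _)
  rw [← finDensity_comp_fst (β := ((Set.range ι)ᶜ : Set I) → V) P,
    ← finDensity_comp_equiv E]
  rfl

/-- Jensen's inequality for cloning one side of a bipartite relation. -/
lemma pow_finDensity_le_finDensity_forall {X Y : Type*} [Finite X] [Finite Y] [Nonempty X]
    [Nonempty Y] (Q : X → Y → Prop) {a : ℕ} (ha : 0 < a) :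
    finDensity (fun p : X × Y => Q p.1 p.2) ^ a ≤
      finDensity (fun p : (Fin a → X) × Y => ∀ i, Q (p.1 i) p.2) := by
  classical
  have := Fintype.ofFinite X
  have := Fintype.ofFinite Y
  have e₁ : {p : X × Y // Q p.1 p.2} ≃ Σ y, {x // Q x y} :=
    { toFun := fun p => ⟨p.1.2, p.1.1, p.2⟩
      invFun := fun p => ⟨(p.2.1, p.1), p.2.2⟩
      left_inv := fun _ => rfl
      right_inv := fun _ => rfl }
  have e₂ : {p : (Fin a → X) × Y // ∀ i, Q (p.1 i) p.2} ≃ Σ y, (Fin a → {x // Q x y}) :=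
    { toFun := fun p => ⟨p.1.2, fun i => ⟨p.1.1 i, p.2 i⟩⟩
      invFun := fun p => ⟨(fun i => (p.2 i).1, p.1), fun i => (p.2 i).2⟩
      left_inv := fun _ => rfl
      right_inv := fun _ => rfl }
  unfold finDensity
  rw [Nat.card_congr e₁, Nat.card_congr e₂]
  simp only [Nat.card_eq_fintype_card, Fintype.card_sigma, Fintype.card_prod, Fintype.card_fun,
    Fintype.card_fin, Nat.cast_sum, Nat.cast_pow, Nat.cast_mul]
  obtain ⟨b, rfl⟩ : ∃ b, a = b + 1 := ⟨a - 1, by omega⟩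
  have hX : (0 : ℝ) < Fintype.card X := by exact_mod_cast Fintype.card_pos
  have hY : (0 : ℝ) < Fintype.card Y := by exact_mod_cast Fintype.card_pos
  have key := pow_sum_div_card_le_sum_pow (s := (Finset.univ : Finset Y))
    (f := fun y => (Fintype.card {x // Q x y} : ℝ)) (fun _ _ => by positivity) b
  rw [Finset.card_univ, div_le_iff₀ (by positivity)] at key
  rw [div_pow, div_le_div_iff₀ (by positivity) (by positivity)]
  calc _ ≤ ((∑ y, (Fintype.card {x // Q x y} : ℝ) ^ (b + 1)) * (Fintype.card Y : ℝ) ^ b) *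
        ((Fintype.card X : ℝ) ^ (b + 1) * Fintype.card Y) := by gcongr
    _ = _ := by ring

/-- The complete bipartite case of Sidorenko's inequality. -/
lemma pow_finDensity_le_finDensity_forall_forall {X Y : Type*} [Finite X] [Finite Y]
    [Nonempty X] [Nonempty Y] (Q : X → Y → Prop) {a : ℕ} (ha : 0 < a) :
    finDensity (fun p : X × Y => Q p.1 p.2) ^ (a ^ 2) ≤
      finDensity (fun p : (Fin a → X) × (Fin a → Y) => ∀ i j, Q (p.1 i) (p.2 j)) := by
  have h₁ := pow_finDensity_le_finDensity_forall Q ha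
  have h₂ := pow_finDensity_le_finDensity_forall
    (fun (y : Y) (x : Fin a → X) => ∀ i, Q (x i) y) ha
  rw [← finDensity_comp_equiv (Equiv.prodComm Y (Fin a → X))] at h₁
  rw [← finDensity_comp_equiv (Equiv.prodComm (Fin a → X) (Fin a → Y))] at h₂
  calc _ = (finDensity (fun p : X × Y => Q p.1 p.2) ^ a) ^ a := by ring
    _ ≤ _ := pow_le_pow_left₀ (pow_nonneg (finDensity_nonneg _) _) h₁ a
    _ ≤ _ := h₂
    _ ≤ _ := finDensity_mono fun p h i j => h j i

/-- A sequence that strictly decreases with respect to `r`. -/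
def IsDescending {V : Type*} (r : V → V → Prop) {k : ℕ} (h : Fin k → V) : Prop :=
  ∀ ⦃i j⦄, i < j → r (h j) (h i)

lemma IsDescending.cons {V : Type*} {r : V → V → Prop} (hr : IsStrictOrd r) {k : ℕ} {u v : V}
    {h : Fin k → V} (hu : IsDescending r (Fin.cons u h : Fin (k + 1) → V)) (huv : r u v) :
    IsDescending r (Fin.cons v (Fin.cons u h : Fin (k + 1) → V) : Fin (k + 2) → V) := by
  intro i j hij
  induction j using Fin.cases with
  | zero => exact absurd hij (Fin.not_lt_zero i)
  | succ j =>
    induction i using Fin.cases with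
    | zero =>
      induction j using Fin.cases with
      | zero => exact huv
      | succ j => exact hr.2 (hu (Fin.succ_pos j)) huv
    | succ i => exact hu (Fin.succ_lt_succ_iff.1 hij)

/-- Vertices above which there are robustly many descending sequences of length `j`: level `0`
is everything, and a vertex reaches level `j + 1` if more than `d` vertices of level `j` lie
below it. -/
def ReachesLevel {V : Type*} (r : V → V → Prop) (d : ℝ) : ℕ → V → Prop
  | 0, _ => True
  | j + 1, v => d < Nat.card {u // ReachesLevel r d j u ∧ r u v}

lemma ReachesLevel.mono {V : Type*} [Finite V] {r : V → V → Prop} (hr : IsStrictOrd r) {d : ℝ}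
    {j : ℕ} {u v : V} (hu : ReachesLevel r d j u) (huv : r u v) : ReachesLevel r d j v := by
  cases j with
  | zero => trivial
  | succ j =>
    refine lt_of_lt_of_le (show d < _ from hu) ?_
    have h : ∀ w, ReachesLevel r d j w ∧ r w u → ReachesLevel r d j w ∧ r w v :=
      fun w hw => ⟨hw.1, hr.2 hw.2 huv⟩
    exact_mod_cast Nat.card_le_card_of_injective (Subtype.map id h)
      (Subtype.map_injective h Function.injective_id)

lemma ReachesLevel.pow_le_card {V : Type*} [Finite V] {r : V → V → Prop} (hr : IsStrictOrd r)
    {d : ℝ} (hd : 0 ≤ d) {j : ℕ} {v : V} (hv : ReachesLevel r d j v) :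
    d ^ j ≤ Nat.card {h : Fin j → V // IsDescending r (Fin.cons v h : Fin (j + 1) → V)} := by
  classical
  induction j generalizing v with
  | zero =>
    have : Nonempty {h : Fin 0 → V // IsDescending r (Fin.cons v h : Fin 1 → V)} :=
      ⟨⟨Fin.elim0, fun i j hij => by omega⟩⟩
    rw [pow_zero]
    exact_mod_cast Nat.card_pos (α := {h : Fin 0 → V // IsDescending r (Fin.cons v h)})
  | succ j ih =>
    have := Fintype.ofFinite V
    let f : (Σ u : {u // ReachesLevel r d j u ∧ r u v},
        {h : Fin j → V // IsDescending r (Fin.cons u.1 h : Fin (j + 1) → V)}) →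
        {h : Fin (j + 1) → V // IsDescending r (Fin.cons v h : Fin (j + 2) → V)} :=
      fun p => ⟨Fin.cons p.1.1 p.2.1, p.2.2.cons hr p.1.2.2⟩
    have hf : Function.Injective f := by
      rintro ⟨⟨u, hu⟩, h, hh⟩ ⟨⟨u', hu'⟩, h', hh'⟩ hff
      obtain ⟨rfl, rfl⟩ := Fin.cons_injective2 (α := fun _ => V) (congrArg Subtype.val hff)
      rfl
    refine le_trans ?_ (Nat.cast_le.2 (Nat.card_le_card_of_injective f hf))
    rw [Nat.card_sigma, Nat.cast_sum]
    calc d ^ (j + 1) = d * d ^ j := pow_succ' d j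
      _ ≤ (Nat.card {u // ReachesLevel r d j u ∧ r u v} : ℝ) * d ^ j := by
        gcongr; exact le_of_lt hv
      _ = ∑ u : {u // ReachesLevel r d j u ∧ r u v}, d ^ j := by
        simp [Nat.card_eq_fintype_card]
      _ ≤ _ := Finset.sum_le_sum fun u _ => ih u.2.1

/-- If many vertices reach level `j`, then there are many descending sequences. -/
lemma pow_lt_finDensity_isDescending {V : Type*} [Fintype V] {r : V → V → Prop}
    (hr : IsStrictOrd r) {δ : ℝ} (hδ : 0 < δ) {j : ℕ}
    (hj : δ * Fintype.card V <
      Nat.card {v // ReachesLevel r (δ * Fintype.card V) j v}) [Nonempty V] :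
    δ ^ (j + 1) < finDensity (fun h : Fin (j + 1) → V => IsDescending r h) := by
  classical
  have hn : (0 : ℝ) < Fintype.card V := by exact_mod_cast Fintype.card_pos
  set d := δ * Fintype.card V with hd
  have hd0 : 0 < d := mul_pos hδ hn
  let f : (Σ v : {v // ReachesLevel r d j v},
      {h : Fin j → V // IsDescending r (Fin.cons v.1 h : Fin (j + 1) → V)}) →
      {h : Fin (j + 1) → V // IsDescending r h} := fun p => ⟨Fin.cons p.1.1 p.2.1, p.2.2⟩
  have hf : Function.Injective f := by
    rintro ⟨⟨u, hu⟩, h, hh⟩ ⟨⟨u', hu'⟩, h', hh'⟩ hff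
    obtain ⟨rfl, rfl⟩ := Fin.cons_injective2 (α := fun _ => V) (congrArg Subtype.val hff)
    rfl
  have hle : ((Nat.card (Σ v : {v // ReachesLevel r d j v},
      {h : Fin j → V // IsDescending r (Fin.cons v.1 h : Fin (j + 1) → V)}) : ℕ) : ℝ) ≤ _ :=
    Nat.cast_le.2 (Nat.card_le_card_of_injective f hf)
  rw [Nat.card_sigma, Nat.cast_sum] at hle
  have hsum := Finset.sum_le_sum (s := Finset.univ)
    fun (v : {v // ReachesLevel r d j v}) _ => v.2.pow_le_card hr hd0.le
  rw [Finset.sum_const, nsmul_eq_mul, Finset.card_univ, ← Nat.card_eq_fintype_card] at hsum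
  unfold finDensity
  rw [Nat.card_fun, Nat.card_fin, Nat.card_eq_fintype_card (α := V), lt_div_iff₀ (by
    push_cast; positivity), Nat.cast_pow, ← mul_pow, ← hd, pow_succ']
  exact (mul_lt_mul_of_pos_right hj (pow_pos hd0 j)).trans_le (hsum.trans hle)

/-- Cloning the entries of descending sequences, odd and even positions separately, produces
homomorphisms of any graph with a `k`-colouring whose classes have at most `a` vertices. -/
lemma pow_finDensity_isDescending_le {W V : Type*} [Finite W] [Finite V] [Nonempty V]
    {F : SimpleGraph W} {G : SimpleGraph V} {r : V → V → Prop} (hr : IsStrictOrd r)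
    (hG : ∀ x y, r x y → G.Adj x y) {k a : ℕ} (ha : 0 < a) (c : F.Coloring (Fin k))
    {i : W → Fin a} (hi : Function.Injective fun w => (i w, c w)) :
    finDensity (fun h : Fin k → V => IsDescending r h) ^ (a ^ 2) ≤
      finDensity (fun f : W → V => IsGraphHom F G f) := by
  classical
  let mix : (Fin k → V) → (Fin k → V) → Fin k → V :=
    fun x y j => if Even j.1 then x j else y j
  have hchain : finDensity (fun h : Fin k → V => IsDescending r h) =
      finDensity (fun p : (Fin k → V) × (Fin k → V) => IsDescending r (mix p.1 p.2)) := by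
    let ι : Fin k → Fin k ⊕ Fin k := fun j => if Even j.1 then Sum.inl j else Sum.inr j
    have hι : Function.Injective ι := by
      intro x y hxy
      dsimp only [ι] at hxy
      split_ifs at hxy <;> simp_all
    rw [← finDensity_comp_injective hι,
      ← finDensity_comp_equiv (Equiv.sumArrowEquivProdArrow (Fin k) (Fin k) V)]
    congr 1
    funext g
    congr 1
    funext j
    simp only [mix, ι, Function.comp_apply]
    split_ifs <;> rfl
  let place : (Fin a → Fin k → V) × (Fin a → Fin k → V) → W → V :=
    fun p w => mix (p.1 (i w)) (p.2 (i w)) (c w)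
  have hplace : finDensity (fun f : W → V => IsGraphHom F G f) =
      finDensity (fun p : (Fin a → Fin k → V) × (Fin a → Fin k → V) =>
        IsGraphHom F G (place p)) := by
    let ι : W → (Fin a × Fin k) ⊕ (Fin a × Fin k) :=
      fun w => if Even (c w).1 then Sum.inl (i w, c w) else Sum.inr (i w, c w)
    have hι : Function.Injective ι := by
      intro x y hxy
      dsimp only [ι] at hxy
      apply hi
      split_ifs at hxy <;> simp_all
    let e := (Equiv.sumArrowEquivProdArrow (Fin a × Fin k) (Fin a × Fin k) V).trans
      (Equiv.prodCongr (Equiv.curry (Fin a) (Fin k) V) (Equiv.curry (Fin a) (Fin k) V))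
    rw [← finDensity_comp_injective hι, ← finDensity_comp_equiv e]
    congr 1
    funext g
    congr 1
    funext w
    simp only [place, mix, ι, Function.comp_apply]
    split_ifs <;> rfl
  rw [hchain, hplace]
  refine (pow_finDensity_le_finDensity_forall_forall
    (fun x y : Fin k → V => IsDescending r (mix x y)) ha).trans (finDensity_mono ?_)
  rintro ⟨x, y⟩ hxy
  have hlt : ∀ u w, c u < c w → r (place (x, y) w) (place (x, y) u) := by
    intro u w huw
    have huw' : (c u).1 < (c w).1 := huw
    by_cases hu : Even (c u).1 <;> by_cases hw : Even (c w).1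
    · have hne : (c u).1 + 1 ≠ (c w).1 := fun h => by
        rw [← h] at hw; exact (Nat.even_add_one.1 hw) hu
      let m : Fin k := ⟨(c u).1 + 1, by omega⟩
      have hm : ¬ Even m.1 := fun h => (Nat.even_add_one.1 h) hu
      have h₁ := hxy (i u) (i u) (show c u < m from Nat.lt_succ_self _)
      have h₂ := hxy (i w) (i u) (show m < c w from by
        change (c u).1 + 1 < (c w).1; omega)
      simp only [mix, place, hu, hw, hm, if_true, if_false] at h₁ h₂ ⊢
      exact hr.2 h₂ h₁
    · have h := hxy (i u) (i w) huw
      simpa only [mix, place, hu, hw, if_true, if_false] using h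
    · have h := hxy (i w) (i u) huw
      simpa only [mix, place, hu, hw, if_true, if_false] using h
    · have hne : (c u).1 + 1 ≠ (c w).1 := fun h => by
        rw [← h] at hw; exact hw (Nat.even_add_one.2 hu)
      let m : Fin k := ⟨(c u).1 + 1, by omega⟩
      have hm : Even m.1 := Nat.even_add_one.2 hu
      have h₁ := hxy (i u) (i u) (show c u < m from Nat.lt_succ_self _)
      have h₂ := hxy (i u) (i w) (show m < c w from by
        change (c u).1 + 1 < (c w).1; omega)
      simp only [mix, place, hu, hw, hm, if_true, if_false] at h₁ h₂ ⊢
      exact hr.2 h₂ h₁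
  intro u w huw
  rcases lt_or_gt_of_ne (c.valid huw) with h | h
  · exact (hG _ _ (hlt u w h)).symm
  · exact hG _ _ (hlt w u h)

lemma colorable_chromNum {V : Type*} [Fintype V] (G : SimpleGraph V) :
    G.Colorable (chromNum G) :=
  Nat.sInf_mem (s := {n | G.Colorable n}) ⟨_, G.colorable_of_fintype⟩

lemma card_le_indepNum {V : Type*} [Fintype V] {G : SimpleGraph V} {s : Finset V}
    (hs : ∀ x ∈ s, ∀ y ∈ s, ¬ G.Adj x y) : s.card ≤ indepNum G :=
  le_csSup ⟨Fintype.card V, by rintro _ ⟨t, rfl, -⟩; exact t.card_le_univ⟩ ⟨s, rfl, hs⟩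

lemma indepNum_pos {V : Type*} [Fintype V] [Nonempty V] (G : SimpleGraph V) :
    0 < indepNum G := by
  have h := card_le_indepNum (G := G) (s := {Classical.arbitrary V}) (by simp)
  rwa [Finset.card_singleton] at h

/-- The vertices of each colour class can be numbered below the independence number. -/
lemma exists_injective_prod_coloring {V α : Type*} [Fintype V] {G : SimpleGraph V}
    (c : G.Coloring α) :
    ∃ i : V → Fin (indepNum G), Function.Injective fun v => (i v, c v) := by
  classical
  have h : ∀ b, Nonempty ({v // c v = b} ↪ Fin (indepNum G)) := by
    intro b
    apply Function.Embedding.nonempty_of_card_le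
    rw [Fintype.card_fin, Fintype.card_subtype]
    apply card_le_indepNum
    intro x hx y hy hxy
    rw [Finset.mem_filter] at hx hy
    exact c.valid hxy (hx.2.trans hy.2.symm)
  have f := fun b => (h b).some
  have key : ∀ b y (hy : c y = b), (f (c y)) ⟨y, rfl⟩ = f b ⟨y, hy⟩ := by
    rintro _ y rfl
    rfl
  refine ⟨fun v => f (c v) ⟨v, rfl⟩, fun x y hxy => ?_⟩
  obtain ⟨h₁, h₂⟩ := Prod.mk.inj hxy
  exact congrArg Subtype.val ((f (c x)).injective (h₁.trans (key (c x) y h₂.symm)))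

/-- A homomorphism density is a density in the space of all maps. -/
lemma graphHomDensity_eq_finDensity {W V : Type*} [Fintype W] [Fintype V] (F : SimpleGraph W)
    (G : SimpleGraph V) :
    graphHomDensity F G = finDensity (fun f : W → V => IsGraphHom F G f) := by
  simp [graphHomDensity, finDensity, Nat.card_fun]

/-- If few vertices reach level `K`, then a `K`-colourable comparability graph is obtained by
deleting few edges. -/
lemma exists_colorable_comparability {V : Type*} [Fintype V] {G : SimpleGraph V}
    {r : V → V → Prop} (hr : IsStrictOrd r) (hG : ∀ x y, G.Adj x y ↔ (r x y ∨ r y x))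
    {d : ℝ} {K : ℕ} (hK : 0 < K) (hd : Nat.card {v // ReachesLevel r d K v} ≤ d) :
    ∃ G' : SimpleGraph V, G' ≤ G ∧ IsComparability G' ∧ G'.Colorable K ∧
      (deletedEdges G G' : ℝ) ≤ 2 * d * Fintype.card V := by
  classical
  let ℓ : V → ℕ := fun v => Nat.findGreatest (fun j => ReachesLevel r d j v) K
  have hℓK : ∀ v, ℓ v ≤ K := fun v => Nat.findGreatest_le K
  have hℓ : ∀ v, ReachesLevel r d (ℓ v) v := fun v =>
    Nat.findGreatest_spec (P := fun j => ReachesLevel r d j v) (Nat.zero_le K) trivial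
  have hmono : ∀ u v, r u v → ℓ u ≤ ℓ v := fun u v huv =>
    Nat.le_findGreatest (hℓK u) ((hℓ u).mono hr huv)
  let s : V → V → Prop := fun u v => r u v ∧ ℓ u < ℓ v ∧ ℓ v < K
  have hs : IsStrictOrd s :=
    ⟨fun x h => hr.1 x h.1, fun x y z hxy hyz =>
      ⟨hr.2 hxy.1 hyz.1, hxy.2.1.trans hyz.2.1, hyz.2.2⟩⟩
  let G' : SimpleGraph V :=
    { Adj := fun x y => s x y ∨ s y x
      symm := ⟨fun _ _ => Or.symm⟩
      loopless := ⟨fun x h => h.elim (hs.1 x) (hs.1 x)⟩ }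
  refine ⟨G', fun x y h => (hG x y).2 (h.imp And.left And.left), ⟨s, hs, fun _ _ => Iff.rfl⟩,
    ?_, ?_⟩
  · let c : V → Fin K := fun v => if h : ℓ v < K then ⟨ℓ v, h⟩ else ⟨0, hK⟩
    have hc : ∀ x y, s x y → c x ≠ c y := by
      rintro x y ⟨-, hlt, hy⟩ hxy
      simp only [c, hy, hlt.trans hy, dif_pos, Fin.mk.injEq] at hxy
      omega
    exact ⟨SimpleGraph.Coloring.mk c fun {x y} h =>
      h.elim (hc x y) fun h' => (hc y x h').symm⟩
  · let below : V → Type _ := fun v => {u // r u v ∧ ¬ s u v}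
    have hfin : ∀ v, Finite (below v) := fun v => Subtype.finite
    have hrep : ∀ e : {e : Sym2 V // e ∈ G.edgeSet ∧ e ∉ G'.edgeSet},
        ∃ p : Σ v, below v, s(p.2.1, p.1) = e.1 := by
      rintro ⟨e, he, he'⟩
      induction e using Sym2.ind with
      | _ x y =>
        have hn : ¬ (s x y ∨ s y x) := he'
        rcases (hG x y).1 he with h | h
        · exact ⟨⟨y, x, h, fun h' => hn (Or.inl h')⟩, rfl⟩
        · exact ⟨⟨x, y, h, fun h' => hn (Or.inr h')⟩, Sym2.eq_swap⟩
    choose f f_spec using hrep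
    have hf : Function.Injective f := by
      intro e e' hee
      have h₁ := (f_spec e).symm
      rw [hee, f_spec e'] at h₁
      exact Subtype.ext h₁
    have hcard : (deletedEdges G G' : ℝ) ≤ ∑ v, (Nat.card (below v) : ℝ) := by
      have h := Nat.card_le_card_of_injective f hf
      rw [Nat.card_sigma] at h
      exact_mod_cast h
    have hd0 : 0 ≤ d := (Nat.cast_nonneg _).trans hd
    have hbelow : ∀ v, (Nat.card (below v) : ℝ) ≤
        d + if ReachesLevel r d K v then (Fintype.card V : ℝ) else 0 := by
      intro v
      split_ifs with hv
      · have h : Nat.card (below v) ≤ Fintype.card V := by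
          rw [← Nat.card_eq_fintype_card]
          exact Nat.card_le_card_of_injective _ Subtype.val_injective
        have h' : (Nat.card (below v) : ℝ) ≤ Fintype.card V := by exact_mod_cast h
        linarith
      · have hlt : ℓ v < K := lt_of_le_of_ne (hℓK v) fun h => hv (h ▸ hℓ v)
        have hnext : ¬ ReachesLevel r d (ℓ v + 1) v := fun h =>
          absurd (Nat.le_findGreatest (P := fun j => ReachesLevel r d j v) hlt h)
            (Nat.not_succ_le_self _)
        have hsub : ∀ u, r u v ∧ ¬ s u v → ReachesLevel r d (ℓ v) u ∧ r u v := by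
          rintro u ⟨huv, hns⟩
          have : ℓ u = ℓ v := le_antisymm (hmono u v huv)
            (not_lt.1 fun h => hns ⟨huv, h, hlt⟩)
          exact ⟨this ▸ hℓ u, huv⟩
        rw [add_zero]
        refine le_trans ?_ (not_lt.1 hnext)
        exact_mod_cast Nat.card_le_card_of_injective (Subtype.map id hsub)
          (Subtype.map_injective hsub Function.injective_id)
    calc (deletedEdges G G' : ℝ) ≤ ∑ v, (Nat.card (below v) : ℝ) := hcard
      _ ≤ ∑ v, (d + if ReachesLevel r d K v then (Fintype.card V : ℝ) else 0) :=
        Finset.sum_le_sum fun v _ => hbelow v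
      _ = Fintype.card V * d +
          Nat.card {v // ReachesLevel r d K v} * (Fintype.card V : ℝ) := by
        rw [Finset.sum_add_distrib, ← Finset.sum_filter, Finset.sum_const, Finset.sum_const,
          Nat.card_eq_fintype_card, Fintype.card_subtype]
        simp
      _ ≤ Fintype.card V * d + d * (Fintype.card V : ℝ) := by gcongr
      _ = 2 * d * Fintype.card V := by ring

/-- **Easy testability for monotone classes of comparability graphs** (Corollary 10).
If `F ∈ ℱ` realizes the chromatic and independence numbers of the family `ℱ` and
`t(F,G) ≤ (ε/2)^{χ(ℱ)·α(ℱ)²}` for a comparability graph `G`, then there is a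
`K_{χ(ℱ)}`-free (hence `ℱ`-free) spanning subgraph of `G` that is a comparability graph,
obtained by deleting at most `ε·|V(G)|²` edges. -/
theorem comparability_family_removal (ℱ : Set FinGraph) (F : FinGraph) (hFmem : F ∈ ℱ)
    (hFc : chromNum F.graph = famChrom ℱ) (hFi : indepNum F.graph = famIndep ℱ)
    (h2 : 2 ≤ famChrom ℱ)
    {V : Type*} [Fintype V] (G : SimpleGraph V) (hG : IsComparability G)
    (ε : ℝ) (hε : 0 < ε)
    (hdens : graphHomDensity F.graph G ≤ (ε / 2) ^ (famChrom ℱ * (famIndep ℱ) ^ 2)) :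
    ∃ G' : SimpleGraph V, G' ≤ G ∧ IsComparability G' ∧
      G'.CliqueFree (famChrom ℱ) ∧ (∀ H ∈ ℱ, GraphFreeOf H.graph G') ∧
      (deletedEdges G G' : ℝ) ≤ ε * (Fintype.card V : ℝ) ^ 2 := by
  classical
  obtain ⟨r, hr, hadj⟩ := hG
  set k := famChrom ℱ with hk
  set δ := ε / 2 with hδ
  have hδ0 : 0 < δ := half_pos hε
  have hfew : (Nat.card {v // ReachesLevel r (δ * Fintype.card V) (k - 1) v} : ℝ) ≤
      δ * Fintype.card V := by
    by_contra! hmany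
    have hV : Nonempty V := by
      by_contra hV
      rw [not_nonempty_iff] at hV
      simp at hmany
    have hW : Nonempty (Fin F.n) := by
      by_contra hW
      rw [not_nonempty_iff] at hW
      have h : chromNum F.graph ≤ 0 := Nat.sInf_le (SimpleGraph.Colorable.of_isEmpty 0)
      omega
    have hdesc := pow_lt_finDensity_isDescending hr hδ0 hmany
    rw [Nat.sub_add_cancel (by omega : 1 ≤ k)] at hdesc
    obtain ⟨c⟩ : F.graph.Colorable k := hFc ▸ colorable_chromNum F.graph
    obtain ⟨i, hi⟩ := exists_injective_prod_coloring c
    have ha := indepNum_pos F.graph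
    have hle := pow_finDensity_isDescending_le hr (fun x y h => (hadj x y).2 (Or.inl h)) ha c hi
    rw [← graphHomDensity_eq_finDensity] at hle
    have hlt := pow_lt_pow_left₀ hdesc (by positivity) (pow_pos ha 2).ne'
    rw [← hFi, pow_mul] at hdens
    exact absurd (hlt.trans_le (hle.trans hdens)) (lt_irrefl _)
  obtain ⟨G', hle, hcomp, hcol, hdel⟩ :=
    exists_colorable_comparability hr hadj (by omega : 0 < k - 1) hfew
  refine ⟨G', hle, hcomp, hcol.cliqueFree (by omega), ?_, hdel.trans_eq (by rw [hδ]; ring)⟩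
  rintro H hH ⟨f, -, hf⟩
  have hHcol : H.graph.Colorable (k - 1) :=
    hcol.of_hom (⟨f, fun {x y} h => hf h⟩ : H.graph →g G')
  have h₁ : chromNum H.graph ≤ k - 1 := Nat.sInf_le hHcol
  have h₂ : k ≤ chromNum H.graph := Nat.sInf_le ⟨H, hH, rfl⟩
  omega
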